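/- (Closed-loop dissipation identity, proof of Proposition 3.) Let n, m be positive integers; let α, β, γ, τ_s, τ_l, τ_I, τ_V, τ_a, τ_b be strictly positive reals; let L_s, R_s, C, I_l, Π_c, Π_u ∈ ℝ^{n×n} and L, R ∈ ℝ^{m×m} be diagonal matrices with strictly positive diagonal entries; let B ∈ ℝ^{n×m}, 𝓛 := B R⁻¹ Bᵀ, V_d ∈ ℝⁿ. Suppose I_s, V, u_s*, u_l*, I_s*, V*, λ_a, λ_b : ℝ → ℝⁿ and I : ℝ → ℝᵐ are differentiable and satisfy for all t the closed-loop system: L_s İ_s = −R_s I_s − V + u_s*; L İ = −R I − Bᵀ V; C V̇ = I_s + B I − I_l u_l*; −τ_s u̇_s* = I_s + β u_s* + λ_a; −τ_l u̇_l* = −I_l V − α I_l Π_u⁻¹ I_l (𝟙 − u_l*) − I_l λ_b; −τ_I İ_s* = α Π_c⁻¹ I_s* − R_s λ_a + λ_b; −τ_V V̇* = γ(V* − V_d) − λ_a − 𝓛 λ_b; τ_a λ̇_a = u_s* − R_s I_s* − V*; τ_b λ̇_b = −I_l u_l* + I_s* − 𝓛 V*. Define S_{cl}(t) := ½( İ_sᵀ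 L_s İ_s + İᵀ L İ + V̇ᵀ C V̇ + τ_s‖u̇_s*‖² + τ_l‖u̇_l*‖² + τ_I‖İ_s*‖² + τ_V‖V̇*‖² + τ_a‖λ̇_a‖² + τ_b‖λ̇_b‖² ). Then S_{cl} is differentiable and for all t, S_{cl}'(t) = −İ_sᵀ R_s İ_s − İᵀ R İ − β‖u̇_s*‖² − α u̇_l*ᵀ I_l Π_u⁻¹ I_l u̇_l* − α İ_s*ᵀ Π_c⁻¹ İ_s* − γ‖V̇*‖²; in particular S_{cl}'(t) ≤ 0. -/

import Mathlib

open Matrix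

theorem HasDerivAt.matrix_mulVec {k l : Type*} [Fintype k] [Fintype l] (A : Matrix k l ℝ)
    {x : ℝ → l → ℝ} {x' : l → ℝ} {t : ℝ} (hx : HasDerivAt x x' t) :
    HasDerivAt (fun s => A.mulVec (x s)) (A.mulVec x') t :=
  (LinearMap.toContinuousLinearMap A.mulVecLin).hasFDerivAt.comp_hasDerivAt t hx

/-- If `D v = f` for a positive diagonal matrix `D`, then `vᵀ D v` has derivative `2 vᵀ f'`. -/
theorem hasDerivAt_dotProduct_diagonal_mulVec {k : Type*} [Fintype k] [DecidableEq k]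
    {d : k → ℝ} (hd : ∀ i, 0 < d i) {v f : ℝ → k → ℝ} {f' : k → ℝ} {t : ℝ}
    (hf : HasDerivAt f f' t) (hv : ∀ s, (Matrix.diagonal d).mulVec (v s) = f s) :
    HasDerivAt (fun s => v s ⬝ᵥ (Matrix.diagonal d).mulVec (v s)) (2 * (v t ⬝ᵥ f')) t := by
  have hvi : ∀ s i, v s i = f s i / d i := fun s i => by
    rw [← hv s, Matrix.mulVec_diagonal, mul_div_cancel_left₀ _ (hd i).ne']
  have hfun : (fun s => v s ⬝ᵥ (Matrix.diagonal d).mulVec (v s)) =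
      fun s => ∑ i, f s i / d i * f s i := by
    funext s
    rw [hv s]
    simp only [dotProduct, hvi]
  rw [hfun]
  have hfi := hasDerivAt_pi.1 hf
  refine (HasDerivAt.fun_sum fun i _ => ((hfi i).div_const (d i)).mul (hfi i)).congr_deriv ?_
  simp only [dotProduct, hvi, Finset.mul_sum]
  exact Finset.sum_congr rfl fun i _ => by ring

/-- If `τ v = f` for a positive scalar `τ`, then `τ ‖v‖²` has derivative `2 vᵀ f'`. -/
theorem hasDerivAt_mul_dotProduct_self {k : Type*} [Fintype k] {τ : ℝ} (hτ : 0 < τ)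
    {v f : ℝ → k → ℝ} {f' : k → ℝ} {t : ℝ}
    (hf : HasDerivAt f f' t) (hv : ∀ s, τ • v s = f s) :
    HasDerivAt (fun s => τ * (v s ⬝ᵥ v s)) (2 * (v t ⬝ᵥ f')) t := by
  classical
  have hdiag : ∀ s, (Matrix.diagonal fun _ : k => τ).mulVec (v s) = τ • v s := fun s => by
    ext i
    simp [Matrix.mulVec_diagonal]
  have h := hasDerivAt_dotProduct_diagonal_mulVec (fun _ => hτ) hf
    fun s => (hdiag s).trans (hv s)
  simpa only [hdiag, dotProduct_smul, smul_eq_mul] using h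

theorem dotProduct_mulVec_comm_of_transpose {k l : Type*} [Fintype k] [Fintype l]
    (A : Matrix k l ℝ) (x : k → ℝ) (y : l → ℝ) :
    x ⬝ᵥ A.mulVec y = y ⬝ᵥ Aᵀ.mulVec x := by
  rw [Matrix.dotProduct_mulVec, Matrix.mulVec_transpose, dotProduct_comm]

theorem dotProduct_diagonal_mulVec_nonneg {k : Type*} [Fintype k] [DecidableEq k]
    {d : k → ℝ} (hd : ∀ i, 0 ≤ d i) (x : k → ℝ) :
    0 ≤ x ⬝ᵥ (Matrix.diagonal d).mulVec x := by
  refine Finset.sum_nonneg fun i _ => ?_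
  rw [Matrix.mulVec_diagonal, mul_left_comm]
  exact mul_nonneg (hd i) (mul_self_nonneg _)

theorem inv_diagonal_of_pos {k : Type*} [Fintype k] [DecidableEq k]
    {d : k → ℝ} (hd : ∀ i, 0 < d i) :
    (Matrix.diagonal d)⁻¹ = Matrix.diagonal fun i => (d i)⁻¹ := by
  refine Matrix.inv_eq_right_inv ?_
  rw [Matrix.diagonal_mul_diagonal, ← Matrix.diagonal_one]
  congr 1
  funext i
  exact mul_inv_cancel₀ (hd i).ne'

/-- Closed-loop dissipation identity (proof of Proposition 3): along solutions of the
closed-loop system, the storage function `S_{cl}` satisfies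
`S_{cl}' = −İ_sᵀ R_s İ_s − İᵀ R İ − β‖u̇_s*‖² − α u̇_l*ᵀ I_l Π_u⁻¹ I_l u̇_l*
 − α İ_s*ᵀ Π_c⁻¹ İ_s* − γ‖V̇*‖² ≤ 0`. -/
theorem stmt_12 (n m : ℕ) (hn : 0 < n) (hm : 0 < m)
    (α β γ τs τl τI τV τa τb : ℝ)
    (hα : 0 < α) (hβ : 0 < β) (hγ : 0 < γ)
    (hτs : 0 < τs) (hτl : 0 < τl) (hτI : 0 < τI) (hτV : 0 < τV) (hτa : 0 < τa) (hτb : 0 < τb)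
    (ls rs c il pc pu : Fin n → ℝ)
    (hls : ∀ i, 0 < ls i) (hrs : ∀ i, 0 < rs i) (hc : ∀ i, 0 < c i)
    (hil : ∀ i, 0 < il i) (hpc : ∀ i, 0 < pc i) (hpu : ∀ i, 0 < pu i)
    (l r : Fin m → ℝ) (hl : ∀ k, 0 < l k) (hr : ∀ k, 0 < r k)
    (B : Matrix (Fin n) (Fin m) ℝ)
    (Vd : Fin n → ℝ)
    (Ls Rs C Il Pc Pu 𝓛 : Matrix (Fin n) (Fin n) ℝ)
    (L R : Matrix (Fin m) (Fin m) ℝ)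
    (hLs : Ls = Matrix.diagonal ls) (hRs : Rs = Matrix.diagonal rs)
    (hC : C = Matrix.diagonal c) (hIl : Il = Matrix.diagonal il)
    (hPc : Pc = Matrix.diagonal pc) (hPu : Pu = Matrix.diagonal pu)
    (hL : L = Matrix.diagonal l) (hR : R = Matrix.diagonal r)
    (h𝓛 : 𝓛 = B * R⁻¹ * Bᵀ)
    (Is V uss uls Iss Vs la lb Is' V' uss' uls' Iss' Vs' la' lb' : ℝ → Fin n → ℝ)
    (I I' : ℝ → Fin m → ℝ)
    (hIs : ∀ t, HasDerivAt Is (Is' t) t)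
    (hI : ∀ t, HasDerivAt I (I' t) t)
    (hV : ∀ t, HasDerivAt V (V' t) t)
    (huss : ∀ t, HasDerivAt uss (uss' t) t)
    (huls : ∀ t, HasDerivAt uls (uls' t) t)
    (hIss : ∀ t, HasDerivAt Iss (Iss' t) t)
    (hVs : ∀ t, HasDerivAt Vs (Vs' t) t)
    (hla : ∀ t, HasDerivAt la (la' t) t)
    (hlb : ∀ t, HasDerivAt lb (lb' t) t)
    -- closed-loop dynamics (27)
    (hcl1 : ∀ t, Ls.mulVec (Is' t) = -(Rs.mulVec (Is t)) - V t + uss t)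
    (hcl2 : ∀ t, L.mulVec (I' t) = -(R.mulVec (I t)) - Bᵀ.mulVec (V t))
    (hcl3 : ∀ t, C.mulVec (V' t) = Is t + B.mulVec (I t) - Il.mulVec (uls t))
    (hcl4 : ∀ t, -(τs • uss' t) = Is t + β • uss t + la t)
    (hcl5 : ∀ t, -(τl • uls' t) =
      -(Il.mulVec (V t)) - α • (Il * Pu⁻¹ * Il).mulVec (1 - uls t) - Il.mulVec (lb t))
    (hcl6 : ∀ t, -(τI • Iss' t) = α • Pc⁻¹.mulVec (Iss t) - Rs.mulVec (la t) + lb t)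
    (hcl7 : ∀ t, -(τV • Vs' t) = γ • (Vs t - Vd) - la t - 𝓛.mulVec (lb t))
    (hcl8 : ∀ t, τa • la' t = uss t - Rs.mulVec (Iss t) - Vs t)
    (hcl9 : ∀ t, τb • lb' t = -(Il.mulVec (uls t)) + Iss t - 𝓛.mulVec (Vs t))
    (Scl : ℝ → ℝ)
    (hScl : Scl = fun t => (1 / 2) * (Is' t ⬝ᵥ Ls.mulVec (Is' t)
      + I' t ⬝ᵥ L.mulVec (I' t) + V' t ⬝ᵥ C.mulVec (V' t)
      + τs * (uss' t ⬝ᵥ uss' t) + τl * (uls' t ⬝ᵥ uls' t)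
      + τI * (Iss' t ⬝ᵥ Iss' t) + τV * (Vs' t ⬝ᵥ Vs' t)
      + τa * (la' t ⬝ᵥ la' t) + τb * (lb' t ⬝ᵥ lb' t))) :
    ∀ t, HasDerivAt Scl
        (-(Is' t ⬝ᵥ Rs.mulVec (Is' t)) - I' t ⬝ᵥ R.mulVec (I' t)
          - β * (uss' t ⬝ᵥ uss' t) - α * (uls' t ⬝ᵥ (Il * Pu⁻¹ * Il).mulVec (uls' t))
          - α * (Iss' t ⬝ᵥ Pc⁻¹.mulVec (Iss' t)) - γ * (Vs' t ⬝ᵥ Vs' t)) t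
      ∧ (-(Is' t ⬝ᵥ Rs.mulVec (Is' t)) - I' t ⬝ᵥ R.mulVec (I' t)
          - β * (uss' t ⬝ᵥ uss' t) - α * (uls' t ⬝ᵥ (Il * Pu⁻¹ * Il).mulVec (uls' t))
          - α * (Iss' t ⬝ᵥ Pc⁻¹.mulVec (Iss' t)) - γ * (Vs' t ⬝ᵥ Vs' t)) ≤ 0 := by
  have hQ : Il * Pu⁻¹ * Il = Matrix.diagonal fun i => il i * (pu i)⁻¹ * il i := by
    rw [hIl, hPu, inv_diagonal_of_pos hpu, Matrix.diagonal_mul_diagonal,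
      Matrix.diagonal_mul_diagonal]
  have hPc' : Pc⁻¹ = Matrix.diagonal fun i => (pc i)⁻¹ := by rw [hPc, inv_diagonal_of_pos hpc]
  have hRsT : Rsᵀ = Rs := by rw [hRs, Matrix.diagonal_transpose]
  have hIlT : Ilᵀ = Il := by rw [hIl, Matrix.diagonal_transpose]
  have h𝓛T : 𝓛ᵀ = 𝓛 := by
    rw [h𝓛, hR, inv_diagonal_of_pos hr]
    simp only [Matrix.transpose_mul, Matrix.transpose_transpose, Matrix.diagonal_transpose,
      Matrix.mul_assoc]
  intro t
  constructor
  · have e1 := hasDerivAt_dotProduct_diagonal_mulVec hls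
      ((((hIs t).matrix_mulVec Rs).neg.sub (hV t)).add (huss t))
      (fun s => by rw [← hLs]; exact hcl1 s)
    have e2 := hasDerivAt_dotProduct_diagonal_mulVec hl
      (((hI t).matrix_mulVec R).neg.sub ((hV t).matrix_mulVec Bᵀ))
      (fun s => by rw [← hL]; exact hcl2 s)
    have e3 := hasDerivAt_dotProduct_diagonal_mulVec hc
      (((hIs t).add ((hI t).matrix_mulVec B)).sub ((huls t).matrix_mulVec Il))
      (fun s => by rw [← hC]; exact hcl3 s)
    have e4 := hasDerivAt_mul_dotProduct_self hτs
      (((hIs t).add ((huss t).const_smul β)).add (hla t)).neg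
      (fun s => neg_eq_iff_eq_neg.1 (hcl4 s))
    have e5 := hasDerivAt_mul_dotProduct_self hτl
      (((((hV t).matrix_mulVec Il).neg.sub
        ((((huls t).const_sub 1).matrix_mulVec (Il * Pu⁻¹ * Il)).const_smul α)).sub
        ((hlb t).matrix_mulVec Il)).neg)
      (fun s => neg_eq_iff_eq_neg.1 (hcl5 s))
    have e6 := hasDerivAt_mul_dotProduct_self hτI
      (((((hIss t).matrix_mulVec Pc⁻¹).const_smul α).sub
        ((hla t).matrix_mulVec Rs)).add (hlb t)).neg
      (fun s => neg_eq_iff_eq_neg.1 (hcl6 s))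
    have e7 := hasDerivAt_mul_dotProduct_self hτV
      (((((hVs t).sub_const Vd).const_smul γ).sub (hla t)).sub ((hlb t).matrix_mulVec 𝓛)).neg
      (fun s => neg_eq_iff_eq_neg.1 (hcl7 s))
    have e8 := hasDerivAt_mul_dotProduct_self hτa
      (((huss t).sub ((hIss t).matrix_mulVec Rs)).sub (hVs t)) hcl8
    have e9 := hasDerivAt_mul_dotProduct_self hτb
      ((((huls t).matrix_mulVec Il).neg.add (hIss t)).sub ((hVs t).matrix_mulVec 𝓛)) hcl9
    rw [← hLs] at e1
    rw [← hL] at e2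
    rw [← hC] at e3
    rw [hScl]
    refine (((((((((e1.add e2).add e3).add e4).add e5).add e6).add e7).add e8).add
      e9).const_mul (1 / 2)).congr_deriv ?_
    have c1 := dotProduct_mulVec_comm_of_transpose B (V' t) (I' t)
    have c2 := dotProduct_mulVec_comm_of_transpose Il (V' t) (uls' t)
    have c3 := dotProduct_mulVec_comm_of_transpose Il (lb' t) (uls' t)
    have c4 := dotProduct_mulVec_comm_of_transpose Rs (la' t) (Iss' t)
    have c5 := dotProduct_mulVec_comm_of_transpose 𝓛 (lb' t) (Vs' t)
    rw [hIlT] at c2 c3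
    rw [hRsT] at c4
    rw [h𝓛T] at c5
    simp only [dotProduct_add, dotProduct_sub, dotProduct_neg, dotProduct_smul, smul_eq_mul,
      Matrix.mulVec_neg]
    rw [c1, c2, c3, c4, c5, dotProduct_comm (V' t) (Is' t), dotProduct_comm (uss' t) (Is' t),
      dotProduct_comm (la' t) (uss' t), dotProduct_comm (lb' t) (Iss' t),
      dotProduct_comm (la' t) (Vs' t)]
    ring
  · have p1 := dotProduct_diagonal_mulVec_nonneg (fun i => (hrs i).le) (Is' t)
    have p2 := dotProduct_diagonal_mulVec_nonneg (fun i => (hr i).le) (I' t)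
    have p3 : 0 ≤ β * (uss' t ⬝ᵥ uss' t) :=
      mul_nonneg hβ.le (Finset.sum_nonneg fun i _ => mul_self_nonneg _)
    have p4 := mul_nonneg hα.le (dotProduct_diagonal_mulVec_nonneg
      (fun i => (mul_pos (mul_pos (hil i) (inv_pos.2 (hpu i))) (hil i)).le) (uls' t))
    have p5 := mul_nonneg hα.le (dotProduct_diagonal_mulVec_nonneg
      (fun i => (inv_pos.2 (hpc i)).le) (Iss' t))
    have p6 : 0 ≤ γ * (Vs' t ⬝ᵥ Vs' t) :=
      mul_nonneg hγ.le (Finset.sum_nonneg fun i _ => mul_self_nonneg _)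
    rw [← hRs] at p1
    rw [← hR] at p2
    rw [← hQ] at p4
    rw [← hPc'] at p5
    linarith
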